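/- arXiv:2605.01079 — 3 statements merged into one kernel-verified Lean document; each statement's English description precedes it below -/
import Mathlib

section
/- Let α > 0, v₁, v₂ < α, λ, σ ∈ ℂ with λ ≠ σ, and set v = v₁ + v₂. Then for every t > 0 the following alternative form of the same-order convolution identity holds: ∫_0^t R_{α,v₁}(λ,t−τ) R_{α,v₂}(σ,τ) dτ = (1/(λ−σ)) · ( R_{α,v}(λ,t) − R_{α,v}(σ,t) ), where R_{α,v} is defined by its series with the reciprocal Gamma convention even when v ≥ α. -/
open MeasureTheory

/-- Two-parameter Mittag-Leffler function, using the entire reciprocal Gamma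
function (Mathlib's `Complex.Gamma` vanishes at nonpositive integers, so its
inverse is the entire reciprocal Gamma). -/
noncomputable def mlE (α β : ℝ) (z : ℂ) : ℂ :=
  ∑' n : ℕ, z ^ n * (Complex.Gamma ((α * n + β : ℝ) : ℂ))⁻¹

/-- The `P` function: `P_{α,w}(λ,t) = t^w E_{α,w+1}(λ t^α)`. -/
noncomputable def Pfun (α w : ℝ) (lam : ℂ) (t : ℝ) : ℂ :=
  ((t ^ w : ℝ) : ℂ) * mlE α (w + 1) (lam * ((t ^ α : ℝ) : ℂ))

/-- The `R` (Lorenzo–Hartley) function: `R_{α,v}(λ,t) = t^{α-v-1} E_{α,α-v}(λ t^α)`. -/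
noncomputable def Rfun (α v : ℝ) (lam : ℂ) (t : ℝ) : ℂ :=
  ((t ^ (α - v - 1) : ℝ) : ℂ) * mlE α (α - v) (lam * ((t ^ α : ℝ) : ℂ))

theorem Real.inv_Gamma_le_exp_mul_rpow {M x : ℝ} (hM : 0 < M) (hx : 0 < x) :
    (Real.Gamma x)⁻¹ ≤ Real.exp M * (Real.exp 1 / M) ^ x := by
  have hΓ := Real.Gamma_pos_of_pos hx
  have hint : IntegrableOn (fun s : ℝ => Real.exp (-s) * s ^ (x + 1 - 1)) (Set.Ioi 0) :=
    Real.GammaIntegral_convergent (by linarith)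
  have hMx : 0 < M ^ x := Real.rpow_pos_of_pos hM x
  have hlow : Real.exp (-M) * M ^ x ≤ Real.Gamma (x + 1) := by
    rw [Real.Gamma_eq_integral (by linarith), ← integral_exp_neg_Ioi M, ← integral_mul_const]
    calc ∫ s in Set.Ioi M, Real.exp (-s) * M ^ x
        ≤ ∫ s in Set.Ioi M, Real.exp (-s) * s ^ (x + 1 - 1) := by
          refine setIntegral_mono_on ((integrableOn_exp_neg_Ioi M).mul_const _)
            (hint.mono_set (Set.Ioi_subset_Ioi hM.le)) measurableSet_Ioi fun s hs => ?_
          rw [add_sub_cancel_right]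
          gcongr
          exact (Set.mem_Ioi.1 hs).le
      _ ≤ _ := setIntegral_mono_set hint
          (ae_restrict_of_forall_mem measurableSet_Ioi fun s hs =>
            mul_nonneg (Real.exp_pos _).le (Real.rpow_nonneg (Set.mem_Ioi.1 hs).le _))
          (Set.Ioi_subset_Ioi hM.le).eventuallyLE
  rw [Real.Gamma_add_one hx.ne'] at hlow
  have hxe : x ≤ Real.exp x := by linarith [Real.add_one_le_exp x]
  have hle : Real.exp (-M) * M ^ x ≤ Real.exp x * Real.Gamma x := hlow.trans (by gcongr)
  rw [Real.div_rpow (Real.exp_pos _).le hM.le, Real.exp_one_rpow, inv_le_iff_one_le_mul₀ hΓ]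
  rw [Real.exp_neg, inv_mul_le_iff₀ (Real.exp_pos _)] at hle
  calc (1 : ℝ) = M ^ x / M ^ x := (div_self hMx.ne').symm
    _ ≤ (Real.exp M * (Real.exp x * Real.Gamma x)) / M ^ x := by gcongr
    _ = _ := by ring

/-- The reciprocal Gamma function decays faster than any geometric sequence along an
arithmetic progression. -/
theorem Real.exists_inv_Gamma_le_mul_pow {α β ρ : ℝ} (hα : 0 < α) (hβ : 0 < β) (hρ : 0 < ρ) :
    ∃ C : ℝ, ∀ n : ℕ, (Real.Gamma (α * n + β))⁻¹ ≤ C * ρ ^ n := by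
  set K : ℝ := ρ ^ α⁻¹ with hK
  have hK0 : 0 < K := Real.rpow_pos_of_pos hρ _
  refine ⟨Real.exp (Real.exp 1 / K) * K ^ β, fun n => ?_⟩
  have h := Real.inv_Gamma_le_exp_mul_rpow (M := Real.exp 1 / K) (x := α * n + β)
    (by positivity) (by positivity)
  rw [div_div_cancel₀ (Real.exp_pos 1).ne', Real.rpow_add hK0, Real.rpow_mul hK0.le,
    Real.rpow_natCast] at h
  have hKα : K ^ α = ρ := by
    rw [hK, ← Real.rpow_mul hρ.le, inv_mul_cancel₀ hα.ne', Real.rpow_one]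
  rw [hKα] at h
  linarith

theorem norm_inv_Gamma_ofReal {x : ℝ} (hx : 0 < x) :
    ‖(Complex.Gamma (x : ℂ))⁻¹‖ = (Real.Gamma x)⁻¹ := by
  rw [norm_inv, Complex.Gamma_ofReal, Complex.norm_of_nonneg (Real.Gamma_pos_of_pos hx).le]

theorem summable_norm_mlE {α : ℝ} (hα : 0 < α) (β : ℝ) (z : ℂ) :
    Summable fun n : ℕ => ‖z ^ n * (Complex.Gamma ((α * n + β : ℝ) : ℂ))⁻¹‖ := by
  obtain ⟨N, hN⟩ := exists_nat_gt (-β / α)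
  have hβ : 0 < α * N + β := by
    rw [div_lt_iff₀ hα] at hN
    linarith
  set ρ : ℝ := (2 * (‖z‖ + 1))⁻¹ with hρ
  obtain ⟨C, hC⟩ := Real.exists_inv_Gamma_le_mul_pow hα hβ (ρ := ρ) (by positivity)
  rw [← summable_nat_add_iff N]
  have hr : ‖z‖ * ρ < 1 := by
    rw [hρ, ← div_eq_mul_inv, div_lt_one (by positivity)]
    linarith [norm_nonneg z]
  refine Summable.of_nonneg_of_le (fun n => norm_nonneg _) (fun n => ?_)
    ((summable_geometric_of_lt_one (by positivity) hr).mul_left (‖z‖ ^ N * C))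
  have hn : α * ((n + N : ℕ) : ℝ) + β = α * n + (α * N + β) := by push_cast; ring
  rw [norm_mul, hn, norm_inv_Gamma_ofReal (by positivity), norm_pow]
  calc ‖z‖ ^ (n + N) * (Real.Gamma (α * n + (α * N + β)))⁻¹
      ≤ ‖z‖ ^ (n + N) * (C * ρ ^ n) := by gcongr; exact hC n
    _ = _ := by rw [pow_add, mul_pow]; ring

theorem mlE_eq_add_mul_mlE {α : ℝ} (hα : 0 < α) (β : ℝ) (z : ℂ) :
    mlE α β z = (Complex.Gamma (β : ℂ))⁻¹ + z * mlE α (α + β) z := by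
  unfold mlE
  rw [(summable_norm_mlE hα β z).of_norm.tsum_eq_zero_add, ← tsum_mul_left]
  congr 1
  · simp
  · refine tsum_congr fun n => ?_
    rw [pow_succ, show α * ((n + 1 : ℕ) : ℝ) + β = α * n + (α + β) by push_cast; ring]
    ring

theorem Rfun_eq_tsum (α v : ℝ) (lam : ℂ) {t : ℝ} (ht : 0 < t) :
    Rfun α v lam t = ∑' n : ℕ, lam ^ n * (Complex.Gamma ((α * n + (α - v) : ℝ) : ℂ))⁻¹ *
      ((t ^ (α * n + (α - v) - 1) : ℝ) : ℂ) := by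
  unfold Rfun mlE
  rw [← tsum_mul_left]
  refine tsum_congr fun n => ?_
  rw [show α * n + (α - v) - 1 = (α - v - 1) + α * n by ring, Real.rpow_add ht,
    Real.rpow_mul ht.le, Real.rpow_natCast]
  push_cast
  ring

theorem summable_norm_Rfun {α : ℝ} (hα : 0 < α) (v : ℝ) (lam : ℂ) {t : ℝ} (ht : 0 < t) :
    Summable fun n : ℕ => ‖lam ^ n * (Complex.Gamma ((α * n + (α - v) : ℝ) : ℂ))⁻¹ *
      ((t ^ (α * n + (α - v) - 1) : ℝ) : ℂ)‖ := by
  refine ((summable_norm_mlE hα (α - v) (lam * ((t ^ α : ℝ) : ℂ))).mul_left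
    ‖((t ^ (α - v - 1) : ℝ) : ℂ)‖).congr fun n => ?_
  rw [← norm_mul, show α * n + (α - v) - 1 = (α - v - 1) + α * n by ring, Real.rpow_add ht,
    Real.rpow_mul ht.le, Real.rpow_natCast]
  push_cast
  ring_nf

/-- Convolution of two powers on `(0, t)`: the Beta integral over the reals. -/
theorem integral_sub_rpow_mul_rpow {p q t : ℝ} (hp : 0 < p) (hq : 0 < q) (ht : 0 < t) :
    ∫ τ in (0 : ℝ)..t, (t - τ) ^ (p - 1) * τ ^ (q - 1) =
      t ^ (p + q - 1) * (Real.Gamma p * Real.Gamma q * (Real.Gamma (p + q))⁻¹) := by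
  have h := Complex.betaIntegral_scaled (q : ℂ) (p : ℂ) ht
  have hB := Complex.Gamma_mul_Gamma_eq_betaIntegral (s := (q : ℂ)) (t := (p : ℂ))
    (by simpa using hq) (by simpa using hp)
  have hΓ : Complex.Gamma ((q : ℂ) + p) ≠ 0 := by
    rw [← Complex.ofReal_add, Complex.Gamma_ofReal]
    exact_mod_cast (Real.Gamma_pos_of_pos (by positivity)).ne'
  have hB' : Complex.betaIntegral q p =
      Complex.Gamma q * Complex.Gamma p * (Complex.Gamma ((q : ℂ) + p))⁻¹ := by
    rw [hB]
    field_simp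
  apply Complex.ofReal_injective
  rw [← intervalIntegral.integral_ofReal]
  calc ∫ τ in (0 : ℝ)..t, (((t - τ) ^ (p - 1) * τ ^ (q - 1) : ℝ) : ℂ)
      = ∫ τ in (0 : ℝ)..t, (τ : ℂ) ^ ((q : ℂ) - 1) * ((t : ℂ) - τ) ^ ((p : ℂ) - 1) := by
        refine intervalIntegral.integral_congr fun τ hτ => ?_
        rw [Set.uIcc_of_le ht.le] at hτ
        rw [Complex.ofReal_mul, Complex.ofReal_cpow (sub_nonneg.2 hτ.2),
          Complex.ofReal_cpow hτ.1]
        push_cast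
        ring
    _ = _ := by
        rw [h, hB', Complex.ofReal_mul, Complex.ofReal_cpow ht.le]
        push_cast [← Complex.Gamma_ofReal]
        rw [add_comm (q : ℂ) p]
        ring

theorem intervalIntegrable_sub_rpow_mul_rpow {p q t : ℝ} (hp : 0 < p) (hq : 0 < q) (ht : 0 < t) :
    IntervalIntegrable (fun τ => (t - τ) ^ (p - 1) * τ ^ (q - 1)) volume 0 t := by
  by_contra hni
  have h := integral_sub_rpow_mul_rpow hp hq ht
  rw [intervalIntegral.integral_undef hni] at h
  have h₁ := Real.rpow_pos_of_pos ht (p + q - 1)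
  have h₂ := Real.Gamma_pos_of_pos hp
  have h₃ := Real.Gamma_pos_of_pos hq
  have h₄ := Real.Gamma_pos_of_pos (add_pos hp hq)
  exact absurd h (by positivity)

/-- Convolution of two monomials normalized by the Gamma function, with values in `ℂ`. -/
theorem integral_inv_Gamma_mul_rpow {p q t : ℝ} (hp : 0 < p) (hq : 0 < q) (ht : 0 < t) (a b : ℂ) :
    ∫ τ in (0 : ℝ)..t, (a * (Complex.Gamma (p : ℂ))⁻¹ * (((t - τ) ^ (p - 1) : ℝ) : ℂ)) *
        (b * (Complex.Gamma (q : ℂ))⁻¹ * ((τ ^ (q - 1) : ℝ) : ℂ)) =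
      a * b * (((t ^ (p + q - 1) : ℝ) : ℂ) * (Complex.Gamma ((p + q : ℝ) : ℂ))⁻¹) := by
  have hΓp : (Real.Gamma p : ℂ) ≠ 0 := by exact_mod_cast (Real.Gamma_pos_of_pos hp).ne'
  have hΓq : (Real.Gamma q : ℂ) ≠ 0 := by exact_mod_cast (Real.Gamma_pos_of_pos hq).ne'
  calc _ = ∫ τ in (0 : ℝ)..t, (a * b * (Complex.Gamma (p : ℂ))⁻¹ * (Complex.Gamma (q : ℂ))⁻¹) *
        (((t - τ) ^ (p - 1) * τ ^ (q - 1) : ℝ) : ℂ) := by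
        congr 1 with τ
        push_cast
        ring
    _ = _ := by
        rw [intervalIntegral.integral_const_mul, intervalIntegral.integral_ofReal,
          integral_sub_rpow_mul_rpow hp hq ht]
        simp only [Complex.Gamma_ofReal]
        push_cast
        field_simp

theorem integral_norm_inv_Gamma_mul_rpow {p q t : ℝ} (hp : 0 < p) (hq : 0 < q) (ht : 0 < t)
    (a b : ℂ) :
    ∫ τ in (0 : ℝ)..t, ‖(a * (Complex.Gamma (p : ℂ))⁻¹ * (((t - τ) ^ (p - 1) : ℝ) : ℂ)) *
        (b * (Complex.Gamma (q : ℂ))⁻¹ * ((τ ^ (q - 1) : ℝ) : ℂ))‖ =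
      ‖a‖ * ‖b‖ * (t ^ (p + q - 1) * (Real.Gamma (p + q))⁻¹) := by
  have hΓp := (Real.Gamma_pos_of_pos hp).ne'
  have hΓq := (Real.Gamma_pos_of_pos hq).ne'
  calc _ = ∫ τ in (0 : ℝ)..t, (‖a‖ * ‖b‖ * (Real.Gamma p)⁻¹ * (Real.Gamma q)⁻¹) *
        ((t - τ) ^ (p - 1) * τ ^ (q - 1)) := by
        refine intervalIntegral.integral_congr fun τ hτ => ?_
        rw [Set.uIcc_of_le ht.le] at hτ
        simp only [norm_mul]
        rw [norm_inv_Gamma_ofReal hp, norm_inv_Gamma_ofReal hq,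
          Complex.norm_of_nonneg (Real.rpow_nonneg (sub_nonneg.2 hτ.2) _),
          Complex.norm_of_nonneg (Real.rpow_nonneg hτ.1 _)]
        ring
    _ = _ := by
        rw [intervalIntegral.integral_const_mul, integral_sub_rpow_mul_rpow hp hq ht]
        field_simp

theorem intervalIntegrable_inv_Gamma_mul_rpow {p q t : ℝ} (hp : 0 < p) (hq : 0 < q) (ht : 0 < t)
    (a b : ℂ) :
    IntervalIntegrable (fun τ => (a * (Complex.Gamma (p : ℂ))⁻¹ * (((t - τ) ^ (p - 1) : ℝ) : ℂ)) *
        (b * (Complex.Gamma (q : ℂ))⁻¹ * ((τ ^ (q - 1) : ℝ) : ℂ))) volume 0 t := by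
  have h : IntervalIntegrable (fun τ => (((t - τ) ^ (p - 1) * τ ^ (q - 1) : ℝ) : ℂ)) volume 0 t :=
    ⟨(intervalIntegrable_sub_rpow_mul_rpow hp hq ht).1.ofReal,
      (intervalIntegrable_sub_rpow_mul_rpow hp hq ht).2.ofReal⟩
  convert! h.const_mul (a * b * (Complex.Gamma (p : ℂ))⁻¹ * (Complex.Gamma (q : ℂ))⁻¹) using 2 with τ
  push_cast
  ring

/-- Summing a power-type double series along antidiagonals. -/
theorem sub_mul_eq_of_hasSum_antidiagonal {x y S : ℂ} {c : ℕ → ℂ}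
    (hS : HasSum (fun p : ℕ × ℕ => x ^ p.1 * y ^ p.2 * c (p.1 + p.2)) S)
    (hx : Summable fun n => x ^ n * c n) (hy : Summable fun n => y ^ n * c n) :
    (x - y) * S = x * (∑' n, x ^ n * c n) - y * ∑' n, y ^ n * c n := by
  have h₁ := ((Finset.HasAntidiagonal.sigmaAntidiagonalEquivProd.hasSum_iff.2 hS).sigma
    (fun n => hasSum_fintype _)).mul_left (x - y)
  have h₂ := (hx.hasSum.mul_left x).sub (hy.hasSum.mul_left y)
  refine h₁.unique ?_
  convert! h₂ using 2 with n
  have hgeom := (Commute.all x y).mul_geom_sum₂ (n + 1)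
  have hsum : ∑ p : Finset.HasAntidiagonal.antidiagonal n,
      x ^ p.1.1 * y ^ p.1.2 * c (p.1.1 + p.1.2) =
      (∑ i ∈ Finset.range (n + 1), x ^ i * y ^ (n + 1 - 1 - i)) * c n := by
    rw [Finset.sum_coe_sort (Finset.HasAntidiagonal.antidiagonal n)
        (fun p : ℕ × ℕ => x ^ p.1 * y ^ p.2 * c (p.1 + p.2)),
      Finset.sum_mul, Finset.Nat.sum_antidiagonal_eq_sum_range_succ_mk]
    refine Finset.sum_congr rfl fun i hi => ?_
    have := Finset.mem_range.1 hi
    simp only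
    rw [Nat.add_sub_cancel' (by omega), Nat.add_sub_cancel]
  calc _ = (x - y) * ∑ p : Finset.HasAntidiagonal.antidiagonal n,
        x ^ p.1.1 * y ^ p.1.2 * c (p.1.1 + p.1.2) := rfl
    _ = _ := by
      rw [hsum, ← mul_assoc, hgeom]
      ring

theorem summable_double_inv_Gamma {α β : ℝ} (hα : 0 < α) (hβ : 0 < β) {a b s : ℝ} (ha : 0 ≤ a)
    (hb : 0 ≤ b) (hs : 0 ≤ s) :
    Summable fun p : ℕ × ℕ =>
      a ^ p.1 * b ^ p.2 * (s ^ (p.1 + p.2) * (Real.Gamma (α * (p.1 + p.2 : ℕ) + β))⁻¹) := by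
  set ρ : ℝ := ((a + 1) * (b + 1) * (s + 1) * 2)⁻¹ with hρ
  have hρ0 : 0 < ρ := by positivity
  obtain ⟨C, hC⟩ := Real.exists_inv_Gamma_le_mul_pow hα hβ hρ0
  have ha1 : a * s * ρ < 1 := by
    rw [hρ, ← div_eq_mul_inv, div_lt_one (by positivity)]
    nlinarith [mul_nonneg ha hs, mul_nonneg (mul_nonneg ha hs) hb, mul_nonneg ha hb,
      mul_nonneg hb hs]
  have hb1 : b * s * ρ < 1 := by
    rw [hρ, ← div_eq_mul_inv, div_lt_one (by positivity)]
    nlinarith [mul_nonneg ha hs, mul_nonneg (mul_nonneg ha hs) hb, mul_nonneg ha hb,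
      mul_nonneg hb hs]
  have hsum := ((summable_geometric_of_lt_one (by positivity) ha1).mul_of_nonneg
    (summable_geometric_of_lt_one (by positivity) hb1) (fun n => by positivity)
    (fun n => by positivity)).mul_left C
  refine Summable.of_nonneg_of_le (fun p => ?_) (fun p => ?_) hsum
  · have := Real.Gamma_pos_of_pos (show 0 < α * (p.1 + p.2 : ℕ) + β by positivity)
    positivity
  · calc _ ≤ a ^ p.1 * b ^ p.2 * (s ^ (p.1 + p.2) * (C * ρ ^ (p.1 + p.2))) := by
          gcongr
          exact hC _
      _ = _ := by
          simp only [mul_pow, pow_add]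
          ring

/-- The convolution of two `R` functions of the same order as an absolutely convergent double
series. -/
theorem hasSum_conv_Rfun {α v₁ v₂ : ℝ} (hα : 0 < α) (hv₁ : v₁ < α) (hv₂ : v₂ < α)
    (lam sig : ℂ) {t : ℝ} (ht : 0 < t) :
    HasSum (fun p : ℕ × ℕ => lam ^ p.1 * sig ^ p.2 *
        (((t ^ (α * (p.1 + p.2 : ℕ) + (α - (v₁ + v₂ - α)) - 1) : ℝ) : ℂ) *
          (Complex.Gamma ((α * (p.1 + p.2 : ℕ) + (α - (v₁ + v₂ - α)) : ℝ) : ℂ))⁻¹))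
      (∫ τ in (0 : ℝ)..t, Rfun α v₁ lam (t - τ) * Rfun α v₂ sig τ) := by
  let F : ℕ × ℕ → ℝ → ℂ := fun p τ =>
    (lam ^ p.1 * (Complex.Gamma ((α * p.1 + (α - v₁) : ℝ) : ℂ))⁻¹ *
      (((t - τ) ^ (α * p.1 + (α - v₁) - 1) : ℝ) : ℂ)) *
    (sig ^ p.2 * (Complex.Gamma ((α * p.2 + (α - v₂) : ℝ) : ℂ))⁻¹ *
      ((τ ^ (α * p.2 + (α - v₂) - 1) : ℝ) : ℂ))
  have hp (n : ℕ) : 0 < α * n + (α - v₁) := by have := sub_pos.2 hv₁; positivity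
  have hq (n : ℕ) : 0 < α * n + (α - v₂) := by have := sub_pos.2 hv₂; positivity
  have hβ : 0 < α - (v₁ + v₂ - α) := by linarith
  have hexp (p : ℕ × ℕ) : (α * p.1 + (α - v₁)) + (α * p.2 + (α - v₂)) =
      α * (p.1 + p.2 : ℕ) + (α - (v₁ + v₂ - α)) := by push_cast; ring
  have hint (p : ℕ × ℕ) : Integrable (F p) (volume.restrict (Set.Ioc 0 t)) :=
    (intervalIntegrable_iff_integrableOn_Ioc_of_le ht.le).1
      (intervalIntegrable_inv_Gamma_mul_rpow (hp p.1) (hq p.2) ht (lam ^ p.1) (sig ^ p.2))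
  have hsum : Summable fun p => ∫ τ in Set.Ioc 0 t, ‖F p τ‖ := by
    refine ((summable_double_inv_Gamma hα hβ (norm_nonneg lam) (norm_nonneg sig)
      (Real.rpow_nonneg ht.le α)).mul_left (t ^ (α - (v₁ + v₂ - α) - 1))).congr fun p => ?_
    rw [← intervalIntegral.integral_of_le ht.le,
      integral_norm_inv_Gamma_mul_rpow (hp p.1) (hq p.2) ht, hexp,
      add_sub_assoc (α * ((p.1 + p.2 : ℕ) : ℝ)), Real.rpow_add ht, Real.rpow_mul ht.le,
      Real.rpow_natCast, norm_pow, norm_pow]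
    ring
  have h := hasSum_integral_of_summable_integral_norm hint hsum
  have hval : ∫ τ in Set.Ioc 0 t, ∑' p, F p τ =
      ∫ τ in (0 : ℝ)..t, Rfun α v₁ lam (t - τ) * Rfun α v₂ sig τ := by
    rw [intervalIntegral.integral_of_le ht.le, integral_Ioc_eq_integral_Ioo,
      integral_Ioc_eq_integral_Ioo]
    refine setIntegral_congr_fun measurableSet_Ioo fun τ hτ => ?_
    rw [Rfun_eq_tsum α v₁ lam (sub_pos.2 hτ.2), Rfun_eq_tsum α v₂ sig hτ.1,
      tsum_mul_tsum_of_summable_norm (summable_norm_Rfun hα v₁ lam (sub_pos.2 hτ.2))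
        (summable_norm_Rfun hα v₂ sig hτ.1)]
  rw [← hval]
  refine Eq.mp (congrArg (HasSum · _) (funext fun p => ?_)) h
  rw [← intervalIntegral.integral_of_le ht.le,
    integral_inv_Gamma_mul_rpow (hp p.1) (hq p.2) ht, hexp]

theorem Rfun_eq_add_mul_Rfun {α : ℝ} (hα : 0 < α) (v : ℝ) (lam : ℂ) {t : ℝ} (ht : 0 < t) :
    Rfun α v lam t = ((t ^ (α - v - 1) : ℝ) : ℂ) * (Complex.Gamma ((α - v : ℝ) : ℂ))⁻¹ +
      lam * Rfun α (v - α) lam t := by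
  unfold Rfun
  rw [mlE_eq_add_mul_mlE hα, show α - (v - α) = α + (α - v) by ring,
    show α + (α - v) - 1 = α + (α - v - 1) by ring, Real.rpow_add ht α]
  push_cast
  ring

/-- Alternative form of the same-order convolution identity for `R`
functions (here `R_{α,v}` is given by its series with the reciprocal Gamma
convention, which is valid even when `v ≥ α`). -/
theorem conv_Rfun_same_order_alt (α v₁ v₂ : ℝ) (hα : 0 < α) (hv₁ : v₁ < α) (hv₂ : v₂ < α)
    (lam sig : ℂ) (hls : lam ≠ sig) (t : ℝ) (ht : 0 < t) :
    (∫ τ in (0 : ℝ)..t, Rfun α v₁ lam (t - τ) * Rfun α v₂ sig τ) =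
      (1 / (lam - sig)) * (Rfun α (v₁ + v₂) lam t - Rfun α (v₁ + v₂) sig t) := by
  have hcoef (z : ℂ) (n : ℕ) := mul_right_comm (z ^ n)
    (Complex.Gamma ((α * n + (α - (v₁ + v₂ - α)) : ℝ) : ℂ))⁻¹
    ((t ^ (α * n + (α - (v₁ + v₂ - α)) - 1) : ℝ) : ℂ)
  have hsum (z : ℂ) := (summable_norm_Rfun hα (v₁ + v₂ - α) z ht).of_norm
  have hR (z : ℂ) := Rfun_eq_tsum α (v₁ + v₂ - α) z ht
  simp only [hcoef, mul_assoc] at hsum hR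
  have h := sub_mul_eq_of_hasSum_antidiagonal
    (c := fun n => ((t ^ (α * n + (α - (v₁ + v₂ - α)) - 1) : ℝ) : ℂ) *
      (Complex.Gamma ((α * n + (α - (v₁ + v₂ - α)) : ℝ) : ℂ))⁻¹)
    (hasSum_conv_Rfun hα hv₁ hv₂ lam sig ht) (hsum lam) (hsum sig)
  rw [← hR, ← hR] at h
  rw [one_div, eq_inv_mul_iff_mul_eq₀ (sub_ne_zero.2 hls), h,
    Rfun_eq_add_mul_Rfun hα (v₁ + v₂) lam ht, Rfun_eq_add_mul_Rfun hα (v₁ + v₂) sig ht]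
  ring
end

section
/- Let α > 0, w₁, w₂ > −1, λ ∈ ℂ, and set w = w₁ + w₂. Then for every t > 0 the convolution of two P functions with the same order and the same eigenvalue satisfies ∫_0^t P_{α,w₁}(λ,t−τ) P_{α,w₂}(λ,τ) dτ = (t/α) P_{α, w}(λ,t) + ((α−w−1)/α) P_{α, w+1}(λ,t). Equivalently, in Mittag-Leffler form: (t^{w₁}E_{α,w₁+1}(λt^α)) * (t^{w₂}E_{α,w₂+1}(λt^α)) = (1/α) t^{w+1} E_{α,w+1}(λ t^α) + ((α−w−1)/α) t^{w+1} E_{α,w+2}(λ t^α). -/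
open MeasureTheory

theorem rpow_mul_exp_neg_le_Gamma {R s : ℝ} (hR : 0 < R) (hs : 1 ≤ s) :
    R ^ (s - 1) * Real.exp (-R) ≤ Real.Gamma s := by
  have hs0 : 0 < s := by linarith
  have hint := Real.GammaIntegral_convergent hs0
  have hsub : Set.Ioi R ⊆ Set.Ioi (0 : ℝ) := Set.Ioi_subset_Ioi hR.le
  rw [Real.Gamma_eq_integral hs0]
  calc R ^ (s - 1) * Real.exp (-R)
      = ∫ x in Set.Ioi R, R ^ (s - 1) * Real.exp (-x) := by
        rw [integral_const_mul, integral_exp_neg_Ioi]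
    _ ≤ ∫ x in Set.Ioi R, Real.exp (-x) * x ^ (s - 1) := by
        refine setIntegral_mono_on ?_ (hint.mono_set hsub) measurableSet_Ioi fun x hx => ?_
        · exact (integrableOn_exp_neg_Ioi R).const_mul _
        · rw [mul_comm]
          have hRx : R ≤ x := le_of_lt hx
          have : R ^ (s - 1) ≤ x ^ (s - 1) :=
            Real.rpow_le_rpow hR.le hRx (by linarith)
          gcongr
    _ ≤ ∫ x in Set.Ioi 0, Real.exp (-x) * x ^ (s - 1) := by
        refine setIntegral_mono_set hint ?_ hsub.eventuallyLE
        filter_upwards [self_mem_ae_restrict measurableSet_Ioi] with x hx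
        have hx0 : 0 < x := hx
        simp only [Pi.zero_apply]
        positivity

theorem summable_add_one_mul_pow_mul_abs_inv_Gamma {α r : ℝ} (hα : 0 < α) (hr : 0 ≤ r) (b : ℝ) :
    Summable fun n : ℕ => ((n : ℝ) + 1) * (r ^ n * |(Real.Gamma (α * n + b))⁻¹|) := by
  set q : ℝ := r / (2 * r + 1) with hq
  set R : ℝ := (2 * r + 1) ^ (α⁻¹) with hRdef
  have hR : 0 < R := by positivity
  have hRα : R ^ α = 2 * r + 1 := Real.rpow_inv_rpow (by positivity) hα.ne'
  have hq0 : 0 ≤ q := by positivity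
  have hq1 : q < 1 := by rw [hq, div_lt_one (by positivity)]; linarith
  have hgeo : Summable fun n : ℕ => ((n : ℝ) + 1) * q ^ n := by
    have h1 := summable_pow_mul_geometric_of_norm_lt_one (R := ℝ) 1
      (r := q) (by rwa [Real.norm_of_nonneg hq0])
    have h0 := summable_geometric_of_lt_one hq0 hq1
    refine (h1.add h0).congr fun n => ?_
    ring
  refine Summable.of_norm_bounded_eventually_nat
    (g := fun n : ℕ => (Real.exp R * R ^ (1 - b)) * (((n : ℝ) + 1) * q ^ n))
    (hgeo.mul_left _) ?_
  have htend : Filter.Tendsto (fun n : ℕ => α * (n : ℝ) + b) Filter.atTop Filter.atTop :=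
    Filter.tendsto_atTop_add_const_right _ _
      (tendsto_natCast_atTop_atTop.const_mul_atTop hα)
  filter_upwards [htend.eventually_ge_atTop 1] with n hn
  have hG := rpow_mul_exp_neg_le_Gamma hR hn
  have hpos : 0 < R ^ (α * n + b - 1) * Real.exp (-R) := by positivity
  have hinv : |(Real.Gamma (α * n + b))⁻¹| ≤
      Real.exp R * R ^ (1 - b) * ((2 * r + 1) ^ n)⁻¹ := by
    rw [abs_of_nonneg (inv_nonneg.2 (hpos.le.trans hG))]
    refine (inv_anti₀ hpos hG).trans_eq ?_
    rw [mul_inv, ← Real.rpow_neg hR.le, Real.exp_neg, inv_inv,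
      show -(α * (n : ℝ) + b - 1) = (1 - b) - α * n by ring, Real.rpow_sub hR,
      Real.rpow_mul hR.le, hRα, Real.rpow_natCast]
    field_simp
  rw [Real.norm_of_nonneg (by positivity)]
  calc ((n : ℝ) + 1) * (r ^ n * |(Real.Gamma (α * n + b))⁻¹|)
      ≤ ((n : ℝ) + 1) * (r ^ n * (Real.exp R * R ^ (1 - b) * ((2 * r + 1) ^ n)⁻¹)) := by
        gcongr
    _ = _ := by rw [hq, div_pow]; field_simp

theorem integral_rpow_sub_mul_rpow {a b t : ℝ} (ha : 0 < a) (hb : 0 < b) (ht : 0 < t) :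
    ∫ τ in Set.Ioo 0 t, (t - τ) ^ (a - 1) * τ ^ (b - 1) =
      t ^ (a + b - 1) * (Real.Gamma a * Real.Gamma b / Real.Gamma (a + b)) := by
  have h := Complex.betaIntegral_scaled (b : ℂ) (a : ℂ) ht
  rw [Complex.betaIntegral_eq_Gamma_mul_div _ _ (by simpa) (by simpa),
    intervalIntegral.integral_of_le ht.le, integral_Ioc_eq_integral_Ioo] at h
  rw [← Complex.ofReal_inj, ← integral_complex_ofReal]
  have hL : ∫ τ in Set.Ioo 0 t, (((t - τ) ^ (a - 1) * τ ^ (b - 1) : ℝ) : ℂ) =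
      ∫ x in Set.Ioo 0 t, (x : ℂ) ^ ((b : ℂ) - 1) * ((t : ℂ) - x) ^ ((a : ℂ) - 1) := by
    refine setIntegral_congr_fun measurableSet_Ioo fun x hx => ?_
    rw [Complex.ofReal_mul, Complex.ofReal_cpow (sub_nonneg.2 hx.2.le),
      Complex.ofReal_cpow hx.1.le]
    push_cast
    ring
  rw [hL, h]
  push_cast [Complex.ofReal_cpow ht.le, ← Complex.Gamma_ofReal]
  rw [add_comm (b : ℂ) a]
  ring

/-- The real coefficient of `λⁿ` in the series of `Pfun α w λ s`. -/
noncomputable def PfunCoeff (α w : ℝ) (n : ℕ) (s : ℝ) : ℝ :=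
  s ^ (α * n + w) * (Real.Gamma (α * n + w + 1))⁻¹

theorem summable_add_one_mul_norm_PfunCoeff {α : ℝ} (hα : 0 < α) (w : ℝ) (lam : ℂ) {s : ℝ}
    (hs : 0 < s) :
    Summable fun n : ℕ => ((n : ℝ) + 1) * ‖lam ^ n * (PfunCoeff α w n s : ℂ)‖ := by
  have h := (summable_add_one_mul_pow_mul_abs_inv_Gamma hα
    (r := ‖lam‖ * s ^ α) (by positivity) (w + 1)).mul_left (s ^ w)
  refine h.congr fun n => ?_
  rw [norm_mul, norm_pow, Complex.norm_real, PfunCoeff, Real.norm_eq_abs, abs_mul,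
    abs_of_pos (Real.rpow_pos_of_pos hs _), Real.rpow_add hs, Real.rpow_mul hs.le,
    Real.rpow_natCast, mul_pow, add_assoc]
  ring

theorem summable_norm_PfunCoeff {α : ℝ} (hα : 0 < α) (w : ℝ) (lam : ℂ) {s : ℝ} (hs : 0 < s) :
    Summable fun n : ℕ => ‖lam ^ n * (PfunCoeff α w n s : ℂ)‖ := by
  refine (summable_add_one_mul_norm_PfunCoeff hα w lam hs).of_nonneg_of_le
    (fun n => norm_nonneg _) fun n => ?_
  exact le_mul_of_one_le_left (norm_nonneg _) (by linarith [n.cast_nonneg (α := ℝ)])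

theorem Pfun_eq_tsum (α w : ℝ) (lam : ℂ) {s : ℝ} (hs : 0 < s) :
    Pfun α w lam s = ∑' n : ℕ, lam ^ n * (PfunCoeff α w n s : ℂ) := by
  rw [Pfun, mlE, ← tsum_mul_left]
  refine tsum_congr fun n => ?_
  rw [Complex.Gamma_ofReal, PfunCoeff, Real.rpow_add hs, Real.rpow_mul hs.le,
    Real.rpow_natCast, add_assoc]
  push_cast
  ring

theorem integral_PfunCoeff_mul {α w₁ w₂ t : ℝ} (hα : 0 < α) (hw₁ : -1 < w₁) (hw₂ : -1 < w₂)
    (ht : 0 < t) (m n : ℕ) :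
    ∫ τ in Set.Ioo 0 t, PfunCoeff α w₁ m (t - τ) * PfunCoeff α w₂ n τ =
      PfunCoeff α (w₁ + w₂ + 1) (m + n) t := by
  have hm : 0 ≤ α * m := by positivity
  have hn : 0 ≤ α * n := by positivity
  have ha : 0 < α * m + w₁ + 1 := by linarith
  have hb : 0 < α * n + w₂ + 1 := by linarith
  have h := integral_rpow_sub_mul_rpow ha hb ht
  have hGa := (Real.Gamma_pos_of_pos ha).ne'
  have hGb := (Real.Gamma_pos_of_pos hb).ne'
  simp only [add_sub_cancel_right] at h
  calc _ = ∫ τ in Set.Ioo 0 t, ((Real.Gamma (α * m + w₁ + 1))⁻¹ *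
          (Real.Gamma (α * n + w₂ + 1))⁻¹) * ((t - τ) ^ (α * m + w₁) * τ ^ (α * n + w₂)) := by
        congr 1 with τ
        simp only [PfunCoeff]
        ring
    _ = _ := by
        rw [integral_const_mul, h, PfunCoeff, Nat.cast_add,
          show α * ((m : ℝ) + n) + (w₁ + w₂ + 1) = α * m + w₁ + 1 + (α * n + w₂ + 1) - 1 by ring,
          sub_add_cancel]
        field_simp

theorem PfunCoeff_pos {α w s : ℝ} (hα : 0 < α) (hw : -1 < w) (hs : 0 < s) (n : ℕ) :
    0 < PfunCoeff α w n s := by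
  have h : 0 ≤ α * n := by positivity
  exact mul_pos (Real.rpow_pos_of_pos hs _)
    (inv_pos.2 (Real.Gamma_pos_of_pos (by linarith)))

theorem summable_comp_add {f : ℕ → ℂ} (hf : Summable fun n : ℕ => ((n : ℝ) + 1) * ‖f n‖) :
    Summable fun p : ℕ × ℕ => ‖f (p.1 + p.2)‖ := by
  rw [← Finset.HasAntidiagonal.sigmaAntidiagonalEquivProd.summable_iff]
  refine (summable_sigma_of_nonneg fun _ => norm_nonneg _).2 ?_
  refine ⟨fun n => (hasSum_fintype _).summable, hf.congr fun n => ?_⟩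
  rw [tsum_fintype]
  have h : ∀ p : Finset.HasAntidiagonal.antidiagonal n, ‖f (p.1.1 + p.1.2)‖ = ‖f n‖ := fun p => by
    rw [Finset.HasAntidiagonal.mem_antidiagonal.1 p.2]
  simp [Finset.HasAntidiagonal.sigmaAntidiagonalEquivProd, h]

theorem tsum_comp_add {f : ℕ → ℂ} (hf : Summable fun n : ℕ => ((n : ℝ) + 1) * ‖f n‖) :
    ∑' p : ℕ × ℕ, f (p.1 + p.2) = ∑' n : ℕ, ((n : ℂ) + 1) * f n := by
  have hs : Summable fun p : ℕ × ℕ => f (p.1 + p.2) := (summable_comp_add hf).of_norm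
  rw [← Finset.HasAntidiagonal.sigmaAntidiagonalEquivProd.tsum_eq]
  rw [← Finset.HasAntidiagonal.sigmaAntidiagonalEquivProd.summable_iff] at hs
  refine (hs.tsum_sigma' fun n => (hasSum_fintype _).summable).trans ?_
  refine tsum_congr fun n => ?_
  rw [tsum_fintype]
  have h : ∀ p : Finset.HasAntidiagonal.antidiagonal n, f (p.1.1 + p.1.2) = f n := fun p => by
    rw [Finset.HasAntidiagonal.mem_antidiagonal.1 p.2]
  simp [Finset.HasAntidiagonal.sigmaAntidiagonalEquivProd, h]

theorem integral_Pfun_mul_Pfun {α w₁ w₂ t : ℝ} (hα : 0 < α) (hw₁ : -1 < w₁) (hw₂ : -1 < w₂)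
    (lam : ℂ) (ht : 0 < t) :
    ∫ τ in (0 : ℝ)..t, Pfun α w₁ lam (t - τ) * Pfun α w₂ lam τ =
      ∑' n : ℕ, ((n : ℂ) + 1) * (lam ^ n * (PfunCoeff α (w₁ + w₂ + 1) n t : ℂ)) := by
  have hc := summable_add_one_mul_norm_PfunCoeff hα (w₁ + w₂ + 1) lam ht
  rw [← tsum_comp_add hc, intervalIntegral.integral_of_le ht.le, integral_Ioc_eq_integral_Ioo]
  set F : ℕ × ℕ → ℝ → ℂ := fun p τ =>
    lam ^ (p.1 + p.2) * ((PfunCoeff α w₁ p.1 (t - τ) * PfunCoeff α w₂ p.2 τ : ℝ) : ℂ) with hF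
  have hprod : ∀ τ ∈ Set.Ioo 0 t,
      Pfun α w₁ lam (t - τ) * Pfun α w₂ lam τ = ∑' p : ℕ × ℕ, F p τ := fun τ hτ => by
    have hτ' : 0 < t - τ := sub_pos.2 hτ.2
    rw [Pfun_eq_tsum α w₁ lam hτ', Pfun_eq_tsum α w₂ lam hτ.1,
      tsum_mul_tsum_of_summable_norm (summable_norm_PfunCoeff hα w₁ lam hτ')
        (summable_norm_PfunCoeff hα w₂ lam hτ.1)]
    refine tsum_congr fun p => ?_
    simp only [hF, pow_add]
    push_cast
    ring
  have hcoeff : ∀ p : ℕ × ℕ, 0 < PfunCoeff α (w₁ + w₂ + 1) (p.1 + p.2) t := fun p =>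
    PfunCoeff_pos hα (by linarith) ht _
  have hint : ∀ p : ℕ × ℕ, Integrable (F p) (volume.restrict (Set.Ioo 0 t)) := fun p =>
    ((Integrable.of_integral_ne_zero
      (f := fun τ => PfunCoeff α w₁ p.1 (t - τ) * PfunCoeff α w₂ p.2 τ) (by
      rw [integral_PfunCoeff_mul hα hw₁ hw₂ ht]
      exact (hcoeff p).ne')).ofReal).const_mul _
  have hintegral : ∀ p : ℕ × ℕ, ∫ τ in Set.Ioo 0 t, F p τ =
      lam ^ (p.1 + p.2) * (PfunCoeff α (w₁ + w₂ + 1) (p.1 + p.2) t : ℂ) := fun p => by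
    rw [integral_const_mul, integral_complex_ofReal, integral_PfunCoeff_mul hα hw₁ hw₂ ht]
  have hnorm : ∀ p : ℕ × ℕ, ∫ τ in Set.Ioo 0 t, ‖F p τ‖ =
      ‖lam ^ (p.1 + p.2) * (PfunCoeff α (w₁ + w₂ + 1) (p.1 + p.2) t : ℂ)‖ := fun p => by
    rw [norm_mul, Complex.norm_real, Real.norm_of_nonneg (hcoeff p).le,
      ← integral_PfunCoeff_mul hα hw₁ hw₂ ht, ← integral_const_mul]
    refine setIntegral_congr_fun measurableSet_Ioo fun τ hτ => ?_
    simp only [hF]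
    rw [norm_mul, Complex.norm_real, Real.norm_of_nonneg
      (mul_pos (PfunCoeff_pos hα hw₁ (sub_pos.2 hτ.2) _) (PfunCoeff_pos hα hw₂ hτ.1 _)).le]
  have hsum : Summable fun p : ℕ × ℕ => ∫ τ in Set.Ioo 0 t, ‖F p τ‖ := by
    simp only [hnorm]
    exact summable_comp_add
      (f := fun n => lam ^ n * (PfunCoeff α (w₁ + w₂ + 1) n t : ℂ)) hc
  calc _ = ∫ τ in Set.Ioo 0 t, ∑' p : ℕ × ℕ, F p τ :=
        setIntegral_congr_fun measurableSet_Ioo hprod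
    _ = ∑' p : ℕ × ℕ, ∫ τ in Set.Ioo 0 t, F p τ :=
        (integral_tsum_of_summable_integral_norm hint hsum).symm
    _ = _ := tsum_congr hintegral

theorem PfunCoeff_eq_mul_PfunCoeff_add_one (α w : ℝ) (n : ℕ) {t : ℝ} (ht : 0 < t) :
    t * PfunCoeff α w n t = (α * n + w + 1) * PfunCoeff α (w + 1) n t := by
  have h := Complex.one_div_Gamma_eq_self_mul_one_div_Gamma_add_one ((α * n + w + 1 : ℝ) : ℂ)
  rw [← Complex.ofReal_one, ← Complex.ofReal_add, Complex.Gamma_ofReal, Complex.Gamma_ofReal]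
    at h
  norm_cast at h
  rw [PfunCoeff, PfunCoeff, h, ← add_assoc (α * (n : ℝ)) w 1, Real.rpow_add_one ht.ne']
  ring

theorem Pfun_convolution {α w₁ w₂ t : ℝ} (hα : 0 < α) (hw₁ : -1 < w₁) (hw₂ : -1 < w₂)
    (lam : ℂ) (ht : 0 < t) :
    (∫ τ in (0 : ℝ)..t, Pfun α w₁ lam (t - τ) * Pfun α w₂ lam τ) =
      ((t / α : ℝ) : ℂ) * Pfun α (w₁ + w₂) lam t +
        (((α - (w₁ + w₂) - 1) / α : ℝ) : ℂ) * Pfun α ((w₁ + w₂) + 1) lam t := by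
  rw [integral_Pfun_mul_Pfun hα hw₁ hw₂ lam ht, Pfun_eq_tsum _ _ _ ht, Pfun_eq_tsum _ _ _ ht,
    ← tsum_mul_left, ← tsum_mul_left,
    ← ((summable_norm_PfunCoeff hα _ lam ht).of_norm.mul_left _).tsum_add
      ((summable_norm_PfunCoeff hα _ lam ht).of_norm.mul_left _)]
  refine tsum_congr fun n => ?_
  have h := congrArg (fun x : ℝ => (x : ℂ)) (PfunCoeff_eq_mul_PfunCoeff_add_one α (w₁ + w₂) n ht)
  have hα' : (α : ℂ) ≠ 0 := Complex.ofReal_ne_zero.2 hα.ne'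
  push_cast at h ⊢
  field_simp
  linear_combination (-lam ^ n) * h

/-- Same-order, same-eigenvalue convolution identity for `P` functions,
together with its equivalent Mittag-Leffler form. -/
theorem conv_Pfun_same_order_same_eigenvalue (α w₁ w₂ : ℝ) (hα : 0 < α)
    (hw₁ : -1 < w₁) (hw₂ : -1 < w₂) (lam : ℂ) (t : ℝ) (ht : 0 < t) :
    ((∫ τ in (0 : ℝ)..t, Pfun α w₁ lam (t - τ) * Pfun α w₂ lam τ) =
      ((t / α : ℝ) : ℂ) * Pfun α (w₁ + w₂) lam t +
        (((α - (w₁ + w₂) - 1) / α : ℝ) : ℂ) * Pfun α ((w₁ + w₂) + 1) lam t) ∧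
    ((∫ τ in (0 : ℝ)..t,
        (((t - τ) ^ w₁ : ℝ) : ℂ) * mlE α (w₁ + 1) (lam * (((t - τ) ^ α : ℝ) : ℂ)) *
          ((((τ : ℝ) ^ w₂ : ℝ) : ℂ) * mlE α (w₂ + 1) (lam * (((τ : ℝ) ^ α : ℝ) : ℂ)))) =
      ((1 / α : ℝ) : ℂ) * ((t ^ ((w₁ + w₂) + 1) : ℝ) : ℂ) *
          mlE α ((w₁ + w₂) + 1) (lam * ((t ^ α : ℝ) : ℂ)) +
        (((α - (w₁ + w₂) - 1) / α : ℝ) : ℂ) * ((t ^ ((w₁ + w₂) + 1) : ℝ) : ℂ) *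
          mlE α ((w₁ + w₂) + 2) (lam * ((t ^ α : ℝ) : ℂ))) := by
  refine ⟨Pfun_convolution hα hw₁ hw₂ lam ht, (Pfun_convolution hα hw₁ hw₂ lam ht).trans ?_⟩
  rw [Pfun, Pfun, Real.rpow_add_one ht.ne',
    show w₁ + w₂ + 1 + 1 = w₁ + w₂ + 2 by ring]
  push_cast
  ring
end

section
/- Inverse expansion identity for P functions: let N be a positive integer, ζ ∈ ℂ a primitive N-th root of unity, and m an integer with 0 ≤ m < N. Then for every real α > 0, every w > −1, every nonzero λ ∈ ℂ, and every t > 0, (1/N) ∑_{k=0}^{N−1} (λ ζ^k)^{−m} P_{α,w}(λ ζ^k, t) = P_{Nα, w+αm}(λ^N, t). -/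
open MeasureTheory

open Set in
/-- The Gamma function dominates every exponential on the positive reals. -/
theorem exp_mul_rpow_le_Gamma {R s : ℝ} (hR : 0 < R) (hs : 0 < s) :
    Real.exp (-(R + 1)) * (R ^ s / (R + 1)) ≤ Real.Gamma s := by
  have hint := Real.GammaIntegral_convergent hs
  have hsub : Ioc R (R + 1) ⊆ Ioi 0 := fun u hu => hR.trans hu.1
  rw [Real.Gamma_eq_integral hs]
  calc Real.exp (-(R + 1)) * (R ^ s / (R + 1))
      = ∫ _ in Ioc R (R + 1), Real.exp (-(R + 1)) * (R ^ s / (R + 1)) := by simp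
    _ ≤ ∫ u in Ioc R (R + 1), Real.exp (-u) * u ^ (s - 1) := by
        refine setIntegral_mono_on (integrableOn_const (by simp)) (hint.mono_set hsub) measurableSet_Ioc
          fun u hu => ?_
        have hu0 : 0 < u := hR.trans hu.1
        rw [Real.rpow_sub_one hu0.ne']
        have hpow : R ^ s ≤ u ^ s := Real.rpow_le_rpow hR.le hu.1.le hs.le
        have hexp : Real.exp (-(R + 1)) ≤ Real.exp (-u) := Real.exp_le_exp.2 (neg_le_neg hu.2)
        have hle : u ≤ R + 1 := hu.2
        gcongr
    _ ≤ ∫ u in Ioi 0, Real.exp (-u) * u ^ (s - 1) := by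
        refine setIntegral_mono_set hint ?_ hsub.eventuallyLE
        filter_upwards [self_mem_ae_restrict measurableSet_Ioi] with u hu
        have hu0 : (0 : ℝ) < u := hu
        simp only [Pi.zero_apply]
        positivity

/-- The Mittag-Leffler series converges when both parameters are positive. -/
theorem summable_mlE {α β : ℝ} (hα : 0 < α) (hβ : 0 < β) (z : ℂ) :
    Summable fun n : ℕ => z ^ n * (Complex.Gamma ((α * n + β : ℝ) : ℂ))⁻¹ := by
  set x : ℝ := 2 * (‖z‖ + 1) with hx
  have hz : 0 ≤ ‖z‖ := norm_nonneg z
  have hx0 : 0 < x := by positivity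
  set R : ℝ := x ^ α⁻¹ with hRdef
  have hR : 0 < R := Real.rpow_pos_of_pos hx0 _
  have hRα : R ^ α = x := Real.rpow_inv_rpow hx0.le hα.ne'
  have hgeom : Summable fun n : ℕ => (‖z‖ / x) ^ n :=
    summable_geometric_of_lt_one (by positivity) (by rw [div_lt_one hx0]; linarith)
  refine Summable.of_norm_bounded
    (hgeom.mul_left (Real.exp (-(R + 1)) * (R ^ β / (R + 1)))⁻¹) fun n => ?_
  have hs : 0 < α * n + β := by positivity
  have hG := exp_mul_rpow_le_Gamma hR hs
  rw [Real.rpow_add hR, Real.rpow_mul hR.le, hRα, Real.rpow_natCast] at hG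
  rw [norm_mul, norm_pow, norm_inv, Complex.Gamma_ofReal, Complex.norm_real,
    Real.norm_of_nonneg (Real.Gamma_pos_of_pos hs).le]
  calc ‖z‖ ^ n * (Real.Gamma (α * n + β))⁻¹
      ≤ ‖z‖ ^ n * (Real.exp (-(R + 1)) * (x ^ n * R ^ β / (R + 1)))⁻¹ := by gcongr
    _ = (Real.exp (-(R + 1)) * (R ^ β / (R + 1)))⁻¹ * (‖z‖ / x) ^ n := by
        rw [div_pow]
        field_simp

/-- Power sums of the `N`-th roots of unity, twisted by the inverse of the `m`-th power,
vanish off the residue class of `m`. -/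
theorem IsPrimitiveRoot.sum_inv_pow_mul_pow_eq_zero {K : Type*} [Field K] {ζ : K} {N m n : ℕ}
    (h : IsPrimitiveRoot ζ N) (hm : m < N) (hn : n % N ≠ m) :
    ∑ k ∈ Finset.range N, ((ζ ^ k) ^ m)⁻¹ * (ζ ^ k) ^ n = 0 := by
  have hN : 0 < N := by omega
  have hζ0 : ζ ≠ 0 := h.ne_zero hN.ne'
  have hne : (ζ ^ m)⁻¹ * ζ ^ n ≠ 1 := by
    intro he
    rw [inv_mul_eq_one₀ (pow_ne_zero _ hζ0), ← pow_mod_orderOf ζ n, ← h.eq_orderOf] at he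
    exact hn (h.pow_inj (Nat.mod_lt _ hN) hm he.symm)
  have hpow : ((ζ ^ m)⁻¹ * ζ ^ n) ^ N = 1 := by
    rw [mul_pow, inv_pow, pow_right_comm, pow_right_comm ζ n, h.pow_eq_one]
    simp
  have hgeom := mul_neg_geom_sum ((ζ ^ m)⁻¹ * ζ ^ n) N
  rw [hpow, sub_self] at hgeom
  rw [← (mul_eq_zero.1 hgeom).resolve_left (sub_ne_zero.2 hne.symm)]
  refine Finset.sum_congr rfl fun k _ => ?_
  rw [mul_pow, inv_pow, pow_right_comm, pow_right_comm ζ k n]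

/-- Inverse expansion identity for `P` functions: if `ζ` is a primitive
`N`-th root of unity, `0 ≤ m < N`, `λ ≠ 0`, then
`(1/N) ∑_{k=0}^{N-1} (λζ^k)^(-m) P_{α,w}(λζ^k, t) = P_{Nα, w+αm}(λ^N, t)`. -/
theorem Pfun_inverse_expansion (N : ℕ) (hN : 0 < N) (ζ : ℂ) (hζ : ζ ^ N = 1)
    (hprim : ∀ k : ℕ, 0 < k → k < N → ζ ^ k ≠ 1) (m : ℕ) (hm : m < N)
    (α w : ℝ) (hα : 0 < α) (hw : -1 < w) (lam : ℂ) (hlam : lam ≠ 0) (t : ℝ) (ht : 0 < t) :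
    (1 / (N : ℂ)) *
        ∑ k ∈ Finset.range N, (lam * ζ ^ k) ^ (-(m : ℤ)) * Pfun α w (lam * ζ ^ k) t =
      Pfun ((N : ℝ) * α) (w + α * (m : ℝ)) (lam ^ N) t := by
  have hζ' : IsPrimitiveRoot ζ N := IsPrimitiveRoot.mk_of_lt ζ hN hζ hprim
  have hζ0 : ζ ≠ 0 := hζ'.ne_zero hN.ne'
  have hNC : (N : ℂ) ≠ 0 := Nat.cast_ne_zero.2 hN.ne'
  set T : ℂ := ((t ^ α : ℝ) : ℂ) with hT
  set W : ℂ := ((t ^ w : ℝ) : ℂ) with hW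
  set g : ℕ → ℂ := fun n => (Complex.Gamma ((α * n + (w + 1) : ℝ) : ℂ))⁻¹ with hg
  have hsum (k : ℕ) : Summable fun n : ℕ => (lam * ζ ^ k * T) ^ n * g n :=
    summable_mlE hα (by linarith) _
  set F : ℕ → ℂ := fun n => (1 / (N : ℂ)) * (W * (lam ^ m)⁻¹ * (lam * T) ^ n * g n *
    ∑ k ∈ Finset.range N, ((ζ ^ k) ^ m)⁻¹ * (ζ ^ k) ^ n) with hF
  have hL : (1 / (N : ℂ)) *
      ∑ k ∈ Finset.range N, (lam * ζ ^ k) ^ (-(m : ℤ)) * Pfun α w (lam * ζ ^ k) t =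
      ∑' n, F n := by
    simp only [hF, Pfun, mlE, tsum_mul_left]
    congr 1
    calc _ = ∑ k ∈ Finset.range N,
          ∑' n : ℕ, (lam * ζ ^ k) ^ (-(m : ℤ)) * (W * ((lam * ζ ^ k * T) ^ n * g n)) := by
          simp only [tsum_mul_left, hg, hW, hT]
      _ = ∑' n : ℕ, ∑ k ∈ Finset.range N,
          (lam * ζ ^ k) ^ (-(m : ℤ)) * (W * ((lam * ζ ^ k * T) ^ n * g n)) :=
          (Summable.tsum_finsetSum fun k _ => ((hsum k).mul_left _).mul_left _).symm
      _ = _ := by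
          refine tsum_congr fun n => ?_
          rw [Finset.mul_sum]
          refine Finset.sum_congr rfl fun k _ => ?_
          rw [zpow_neg, zpow_natCast, mul_pow, mul_inv, mul_right_comm lam, mul_pow (lam * T)]
          ring
  have hinj : Function.Injective fun j : ℕ => N * j + m := fun i j hij =>
    Nat.eq_of_mul_eq_mul_left hN (Nat.add_right_cancel hij)
  have hsupp : Function.support F ⊆ Set.range fun j : ℕ => N * j + m := by
    intro n hn
    by_cases hnm : n % N = m
    · exact ⟨n / N, by rw [← hnm]; exact Nat.div_add_mod n N⟩
    · exact absurd (by simp [hF, hζ'.sum_inv_pow_mul_pow_eq_zero hm hnm]) hn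
  rw [hL, ← hinj.tsum_eq hsupp, Pfun, mlE, ← tsum_mul_left]
  refine tsum_congr fun j => ?_
  have hone : ∑ k ∈ Finset.range N, ((ζ ^ k) ^ m)⁻¹ * (ζ ^ k) ^ (N * j + m) = N := by
    rw [Finset.sum_congr rfl (g := fun _ => (1 : ℂ)) fun k _ => ?_]
    · simp
    · rw [pow_add, pow_mul, pow_right_comm ζ k N, hζ, one_pow, one_pow, one_mul,
        inv_mul_cancel₀ (pow_ne_zero _ (pow_ne_zero _ hζ0))]
  have hgam : g (N * j + m) =
      (Complex.Gamma (((N : ℝ) * α * j + (w + α * m + 1) : ℝ) : ℂ))⁻¹ := by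
    simp only [hg]
    congr 3
    push_cast
    ring
  have hTN : ((t ^ ((N : ℝ) * α) : ℝ) : ℂ) = T ^ N := by
    rw [mul_comm, Real.rpow_mul ht.le, Real.rpow_natCast, Complex.ofReal_pow]
  have hWm : ((t ^ (w + α * m) : ℝ) : ℂ) = W * T ^ m := by
    rw [Real.rpow_add ht, Real.rpow_mul ht.le, Real.rpow_natCast, Complex.ofReal_mul,
      Complex.ofReal_pow]
  simp only [hF]
  rw [hone, hgam, hTN, hWm, ← mul_pow, ← pow_mul, pow_add, mul_pow lam T m]
  field_simp
end
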